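/- Let q be a nonzero real number. Then for every integer n ≥ 1: G_q(2n) = G_q(n). -/

import Mathlib

noncomputable section

open MeasureTheory Filter Finset

/-- Distance from `x` to the nearest integer. -/
def distInt (x : ℝ) : ℝ := |x - round x|

/-- The Takagi–Landsberg function with parameter `a`:
`𝒯_a(x) = ∑_{n≥0} a^n · dist(2^n x, ℤ)`. -/
def takagi (a : ℝ) (x : ℝ) : ℝ := ∑' n : ℕ, a ^ n * distInt (2 ^ n * x)

/-- Weighted sum-of-binary-digits function: for `j = ∑ ω_i 2^i`,
`s_q(j) = ∑ ω_i q^{i+1}`. -/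
def sqN (q : ℝ) (j : ℕ) : ℝ := ∑ i ∈ Finset.range j, if j.testBit i then q ^ (i + 1) else 0

/-- `S_q(n) = ∑_{j<n} s_q(j)`. -/
def Sq (q : ℝ) (n : ℕ) : ℝ := ∑ j ∈ Finset.range n, sqN q j

/-- `G_q(n) = (1/(p_n q^{k_n})) (S_q(n) - (n/p_n) S_q(p_n))` where `k_n = ⌊log₂ n⌋`,
`p_n = 2^{k_n}`. -/
def Gq (q : ℝ) (n : ℕ) : ℝ :=
  (1 / ((2 ^ Nat.log 2 n : ℝ) * q ^ Nat.log 2 n)) *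
    (Sq q n - ((n : ℝ) / (2 ^ Nat.log 2 n : ℝ)) * Sq q (2 ^ Nat.log 2 n))

theorem sqN_eq_sum_range (q : ℝ) {j m : ℕ} (h : j ≤ m) :
    sqN q j = ∑ i ∈ Finset.range m, if j.testBit i then q ^ (i + 1) else 0 := by
  refine Finset.sum_subset (Finset.range_subset_range.2 h) fun i _ hi => ?_
  have hji : j < 2 ^ i := Nat.lt_of_le_of_lt (by simpa using hi) Nat.lt_two_pow_self
  simp [Nat.testBit_lt_two_pow hji]

theorem sqN_two_mul (q : ℝ) (j : ℕ) : sqN q (2 * j) = q * sqN q j := by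
  rw [sqN_eq_sum_range q (show 2 * j ≤ 2 * j + 1 by lia),
    sqN_eq_sum_range q (show j ≤ 2 * j by lia), Finset.sum_range_succ', Finset.mul_sum]
  simp [Nat.testBit_succ, pow_succ', mul_ite]

theorem sqN_two_mul_add_one (q : ℝ) (j : ℕ) : sqN q (2 * j + 1) = q * sqN q j + q := by
  rw [sqN, sqN_eq_sum_range q (show j ≤ 2 * j by lia), Finset.sum_range_succ', Finset.mul_sum]
  have h : (2 * j + 1) / 2 = j := by lia
  simp [Nat.testBit_succ, pow_succ', mul_ite, h]

theorem Sq_two_mul (q : ℝ) (n : ℕ) : Sq q (2 * n) = 2 * q * Sq q n + n * q := by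
  induction n with
  | zero => simp [Sq]
  | succ n ih =>
    have h : Sq q (2 * (n + 1)) = Sq q (2 * n) + sqN q (2 * n) + sqN q (2 * n + 1) := by
      simp only [Sq, mul_add_one, Finset.sum_range_succ]
    have h' : Sq q (n + 1) = Sq q n + sqN q n := Finset.sum_range_succ _ _
    rw [h, h', ih, sqN_two_mul, sqN_two_mul_add_one]
    push_cast
    ring

theorem Gq_two_mul (q : ℝ) (hq : q ≠ 0) (n : ℕ) (hn : 1 ≤ n) :
    Gq q (2 * n) = Gq q n := by
  have hlog : Nat.log 2 (2 * n) = Nat.log 2 n + 1 := by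
    rw [mul_comm, Nat.log_mul_base one_lt_two (by lia)]
  simp only [Gq, hlog, pow_succ' 2, Sq_two_mul]
  push_cast
  field_simp
  ring

end
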